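/- Let N be a submultiplicative, unitarily invariant norm on the n×n complex matrices and let m ≥ 1. If X₁, …, X_m ∈ M_n are all accretive-dissipative, then ω_N(X₁X₂⋯X_m) ≤ 2^{m/2}·ω_N(X₁)·ω_N(X₂)⋯ω_N(X_m). -/

import Mathlib

open scoped ComplexOrder Matrix

/-- The Hermitian (real) part of a matrix: `Re(X) = (X + X*)/2`. -/
noncomputable def matRe {n : ℕ} (X : Matrix (Fin n) (Fin n) ℂ) :
    Matrix (Fin n) (Fin n) ℂ :=
  (1 / 2 : ℂ) • (X + Xᴴ)

/-- The skew (imaginary) part of a matrix: `Im(X) = (X - X*)/(2i)`. -/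
noncomputable def matIm {n : ℕ} (X : Matrix (Fin n) (Fin n) ℂ) :
    Matrix (Fin n) (Fin n) ℂ :=
  (1 / (2 * Complex.I)) • (X - Xᴴ)

/-- The generalized numerical radius induced by a norm `N`:
`ω_N(X) = sup_θ N(Re(e^{iθ} X))`. -/
noncomputable def gnr {n : ℕ} (N : Matrix (Fin n) (Fin n) ℂ → ℝ)
    (X : Matrix (Fin n) (Fin n) ℂ) : ℝ :=
  ⨆ θ : ℝ, N (matRe (Complex.exp (θ * Complex.I) • X))

/-- The numerical range `W(X) = {⟨Xx, x⟩ : ‖x‖ = 1}` (standard inner product on ℂⁿ). -/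
def numRange {n : ℕ} (X : Matrix (Fin n) (Fin n) ℂ) : Set ℂ :=
  { z | ∃ x : Fin n → ℂ, star x ⬝ᵥ x = 1 ∧ z = star x ⬝ᵥ X.mulVec x }

/-- The sector `S_α = {z : Re z > 0, |Im z| ≤ tan(α) Re z}`. -/
def sector (α : ℝ) : Set ℂ :=
  { z | 0 < z.re ∧ |z.im| ≤ Real.tan α * z.re }

/-- The class `M^s_{n,α}` of matrices `X` such that `W(zX) ⊆ S_α` for some unimodular `z`. -/
def sectClass (n : ℕ) (α : ℝ) : Set (Matrix (Fin n) (Fin n) ℂ) :=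
  { X | ∃ z : ℂ, ‖z‖ = 1 ∧ numRange (z • X) ⊆ sector α }

lemma aux_nonneg {n : ℕ} (N : Matrix (Fin n) (Fin n) ℂ → ℝ)
    (hN0 : ∀ A : Matrix (Fin n) (Fin n) ℂ, N A = 0 ↔ A = 0)
    (hNs : ∀ (c : ℂ) (A : Matrix (Fin n) (Fin n) ℂ), N (c • A) = ‖c‖ * N A)
    (hNa : ∀ A B : Matrix (Fin n) (Fin n) ℂ, N (A + B) ≤ N A + N B)
    (A : Matrix (Fin n) (Fin n) ℂ) : 0 ≤ N A := by
  have h1 := hNa A ((-1 : ℂ) • A)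
  rw [hNs] at h1
  have h2 : A + (-1 : ℂ) • A = 0 := by simp
  rw [h2, (hN0 0).2 rfl] at h1
  simp at h1
  linarith

lemma aux_sum {n : ℕ} (N : Matrix (Fin n) (Fin n) ℂ → ℝ)
    (hN0 : ∀ A : Matrix (Fin n) (Fin n) ℂ, N A = 0 ↔ A = 0)
    (hNa : ∀ A B : Matrix (Fin n) (Fin n) ℂ, N (A + B) ≤ N A + N B)
    {ι : Type} (s : Finset ι) (f : ι → Matrix (Fin n) (Fin n) ℂ) :
    N (∑ i ∈ s, f i) ≤ ∑ i ∈ s, N (f i) := by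
  classical
  induction s using Finset.induction_on with
  | empty => simp [(hN0 0).2 rfl]
  | insert a s ha ih =>
    rw [Finset.sum_insert ha, Finset.sum_insert ha]
    exact (hNa _ _).trans (by linarith)

lemma aux_diag_unitary {n : ℕ} (d : Fin n → ℂ) (hd : ∀ i, ‖d i‖ = 1) :
    Matrix.diagonal d ∈ Matrix.unitaryGroup (Fin n) ℂ := by
  rw [Matrix.mem_unitaryGroup_iff, Matrix.star_eq_conjTranspose, Matrix.diagonal_conjTranspose,
    Matrix.diagonal_mul_diagonal, ← Matrix.diagonal_one]
  congr 1
  funext i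
  have := Complex.mul_conj (d i)
  simp [Complex.mul_conj, Complex.normSq_eq_norm_sq, hd]

lemma aux_sign_sum {n : ℕ} (i j : Fin n) (h : i ≠ j) :
    ∑ s : Fin n → ℤˣ, (((s i : ℤ) : ℂ) * ((s j : ℤ) : ℂ)) = 0 := by
  have := Equiv.sum_comp (Equiv.mulRight (Pi.mulSingle i (-1) : Fin n → ℤˣ))
    (fun s : Fin n → ℤˣ => (((s i : ℤ) : ℂ) * ((s j : ℤ) : ℂ)))
  simp [Pi.mulSingle_eq_of_ne h.symm, Finset.sum_neg_distrib] at this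
  exact self_eq_neg.1 this.symm

lemma aux_pinch {n : ℕ} (N : Matrix (Fin n) (Fin n) ℂ → ℝ)
    (hN0 : ∀ A : Matrix (Fin n) (Fin n) ℂ, N A = 0 ↔ A = 0)
    (hNs : ∀ (c : ℂ) (A : Matrix (Fin n) (Fin n) ℂ), N (c • A) = ‖c‖ * N A)
    (hNa : ∀ A B : Matrix (Fin n) (Fin n) ℂ, N (A + B) ≤ N A + N B)
    (hUI : ∀ U V A : Matrix (Fin n) (Fin n) ℂ, U ∈ Matrix.unitaryGroup (Fin n) ℂ →
      V ∈ Matrix.unitaryGroup (Fin n) ℂ → N (U * A * V) = N A)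
    (T : Matrix (Fin n) (Fin n) ℂ) : N (Matrix.diagonal fun i => T i i) ≤ N T := by
  let D : (Fin n → ℤˣ) → Matrix (Fin n) (Fin n) ℂ :=
    fun s => Matrix.diagonal fun i => ((s i : ℤ) : ℂ)
  have hsq : ∀ u : ℤˣ, ((u : ℤ) : ℂ) * ((u : ℤ) : ℂ) = 1 := by
    intro u
    rcases Int.units_eq_one_or u with h | h <;> simp [h]
  have hD : ∀ s, D s ∈ Matrix.unitaryGroup (Fin n) ℂ := by
    intro s
    apply aux_diag_unitary
    intro i
    rcases Int.units_eq_one_or (s i) with h | h <;> simp [h]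
  have key : ∑ s : Fin n → ℤˣ, D s * T * D s
      = ((Fintype.card (Fin n → ℤˣ) : ℝ) : ℂ) • (Matrix.diagonal fun i => T i i) := by
    ext i j
    simp only [D, Matrix.sum_apply, Matrix.mul_diagonal, Matrix.diagonal_mul, Matrix.smul_apply]
    have e : ∀ s : Fin n → ℤˣ, ((s i : ℤ) : ℂ) * T i j * ((s j : ℤ) : ℂ)
        = (((s i : ℤ) : ℂ) * ((s j : ℤ) : ℂ)) * T i j := fun s => by ring
    simp_rw [e, ← Finset.sum_mul]
    by_cases h : i = j
    · subst h
      simp only [hsq, Matrix.diagonal_apply_eq, Finset.sum_const, Finset.card_univ]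
      simp
    · rw [aux_sign_sum i j h, Matrix.diagonal_apply_ne _ h]
      simp
  have h1 := aux_sum N hN0 hNa Finset.univ (fun s : Fin n → ℤˣ => D s * T * D s)
  rw [key, hNs, Finset.sum_congr rfl (fun s _ => hUI (D s) (D s) T (hD s) (hD s)),
    Finset.sum_const, Finset.card_univ, nsmul_eq_mul] at h1
  have hpos : (0 : ℝ) < (Fintype.card (Fin n → ℤˣ) : ℝ) := by
    exact_mod_cast Fintype.card_pos
  rw [Complex.norm_real, Real.norm_of_nonneg hpos.le] at h1
  exact le_of_mul_le_mul_left h1 hpos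

lemma aux_diag_mono {n : ℕ} (N : Matrix (Fin n) (Fin n) ℂ → ℝ)
    (hNs : ∀ (c : ℂ) (A : Matrix (Fin n) (Fin n) ℂ), N (c • A) = ‖c‖ * N A)
    (hNa : ∀ A B : Matrix (Fin n) (Fin n) ℂ, N (A + B) ≤ N A + N B)
    (hUI : ∀ U V A : Matrix (Fin n) (Fin n) ℂ, U ∈ Matrix.unitaryGroup (Fin n) ℂ →
      V ∈ Matrix.unitaryGroup (Fin n) ℂ → N (U * A * V) = N A)
    (a b : Fin n → ℝ) (ha : ∀ i, 0 ≤ a i) (hab : ∀ i, a i ≤ b i) :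
    N (Matrix.diagonal fun i => (a i : ℂ)) ≤ N (Matrix.diagonal fun i => (b i : ℂ)) := by
  let z : Fin n → ℂ := fun i => ⟨a i / b i, √(1 - (a i / b i) ^ 2)⟩
  have h0 : ∀ i, 0 ≤ a i / b i := fun i => div_nonneg (ha i) ((ha i).trans (hab i))
  have h1 : ∀ i, a i / b i ≤ 1 := fun i => div_le_one_of_le₀ (hab i) ((ha i).trans (hab i))
  have hz : ∀ i, ‖z i‖ = 1 := by
    intro i
    have : Complex.normSq (z i) = 1 := by
      simp only [z, Complex.normSq_mk]
      rw [Real.mul_self_sqrt (by nlinarith [h0 i, h1 i])]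
      ring
    rw [Complex.normSq_eq_norm_sq] at this
    exact (pow_eq_one_iff_of_nonneg (norm_nonneg _) two_ne_zero).1 this
  have hU := aux_diag_unitary z hz
  have hU' := aux_diag_unitary (fun i => (starRingEnd ℂ) (z i)) (fun i => by simp [hz])
  set B := Matrix.diagonal fun i => (b i : ℂ) with hB
  have key : (Matrix.diagonal fun i => (a i : ℂ)) =
      (1 / 2 : ℂ) • (Matrix.diagonal z * B * 1
        + Matrix.diagonal (fun i => (starRingEnd ℂ) (z i)) * B * 1) := by
    rw [hB, mul_one, mul_one, Matrix.diagonal_mul_diagonal, Matrix.diagonal_mul_diagonal,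
      Matrix.diagonal_add, ← Matrix.diagonal_smul]
    congr 1
    funext i
    have e : z i * (b i : ℂ) + (starRingEnd ℂ) (z i) * (b i : ℂ)
        = ((2 * (a i / b i) : ℝ) : ℂ) * (b i : ℂ) := by
      rw [← add_mul, Complex.add_conj]
    have e2 : a i / b i * b i = a i := by
      by_cases hb : b i = 0
      · have := ha i
        have := hab i
        rw [hb] at this ⊢
        simp; linarith
      · field_simp
    simp only [Pi.smul_apply, smul_eq_mul]
    rw [e, ← Complex.ofReal_mul, mul_assoc, e2]
    push_cast
    ring
  rw [key, hNs]
  have h2 := hNa (Matrix.diagonal z * B * 1)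
    (Matrix.diagonal (fun i => (starRingEnd ℂ) (z i)) * B * 1)
  rw [hUI _ _ _ hU (one_mem _), hUI _ _ _ hU' (one_mem _)] at h2
  norm_num at h2 ⊢
  linarith

lemma aux_svd {n : ℕ} (Y : Matrix (Fin n) (Fin n) ℂ) (hY : IsUnit Y) :
    ∃ (U V : Matrix (Fin n) (Fin n) ℂ) (d : Fin n → ℝ),
      U ∈ Matrix.unitaryGroup (Fin n) ℂ ∧ V ∈ Matrix.unitaryGroup (Fin n) ℂ ∧
      (∀ i, 0 ≤ d i) ∧ Y = U * Matrix.diagonal (fun i => (d i : ℂ)) * Vᴴ := by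
  have hP : (Yᴴ * Y).PosDef :=
    Matrix.PosDef.conjTranspose_mul_self Y (Matrix.mulVec_injective_of_isUnit hY)
  have hH := hP.1
  let V : Matrix (Fin n) (Fin n) ℂ := hH.eigenvectorUnitary
  have hV : V ∈ Matrix.unitaryGroup (Fin n) ℂ := hH.eigenvectorUnitary.2
  have hVV : Vᴴ * V = 1 := Matrix.mem_unitaryGroup_iff'.1 hV
  have hVV' : V * Vᴴ = 1 := Matrix.mem_unitaryGroup_iff.1 hV
  let e := hH.eigenvalues
  have he : ∀ i, 0 < e i := hP.eigenvalues_pos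
  have hs : Yᴴ * Y = V * Matrix.diagonal (fun i => (e i : ℂ)) * Vᴴ := by
    have := hH.spectral_theorem
    rw [Unitary.conjStarAlgAut_apply] at this
    exact this
  let d : Fin n → ℝ := fun i => √(e i)
  have hd : ∀ i, 0 < d i := fun i => Real.sqrt_pos.2 (he i)
  let Di := Matrix.diagonal (fun i => (((d i)⁻¹ : ℝ) : ℂ))
  have hDiH : Diᴴ = Di := by
    simp only [Di, Matrix.diagonal_conjTranspose]
    congr 1
    funext i
    simp
  have hDD : Di * Matrix.diagonal (fun i => (d i : ℂ)) = 1 := by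
    simp only [Di, Matrix.diagonal_mul_diagonal]
    rw [← Matrix.diagonal_one]
    congr 1
    funext i
    rw [← Complex.ofReal_mul, inv_mul_cancel₀ (hd i).ne']
    simp
  have hDeD : Di * Matrix.diagonal (fun i => (e i : ℂ)) * Di = 1 := by
    simp only [Di, Matrix.diagonal_mul_diagonal]
    rw [← Matrix.diagonal_one]
    congr 1
    funext i
    rw [← Complex.ofReal_mul, ← Complex.ofReal_mul]
    have : (d i)⁻¹ * e i * (d i)⁻¹ = 1 := by
      have h := Real.mul_self_sqrt (he i).le
      have h' := (hd i).ne'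
      change d i * d i = e i at h
      rw [← h]
      field_simp
    rw [this]; simp
  refine ⟨Y * V * Di, V, d, ?_, hV, fun i => (hd i).le, ?_⟩
  · rw [Matrix.mem_unitaryGroup_iff', Matrix.star_eq_conjTranspose, Matrix.conjTranspose_mul,
      Matrix.conjTranspose_mul, hDiH]
    calc Di * (Vᴴ * Yᴴ) * (Y * V * Di) = Di * (Vᴴ * (Yᴴ * Y) * V) * Di := by
          simp only [mul_assoc]
      _ = Di * ((Vᴴ * V) * Matrix.diagonal (fun i => (e i : ℂ)) * (Vᴴ * V)) * Di := by
          rw [hs]; simp only [mul_assoc]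
      _ = 1 := by rw [hVV, one_mul, mul_one, hDeD]
  · rw [mul_assoc (Y * V) Di, hDD, mul_one, mul_assoc, hVV', mul_one]

lemma aux_conj {n : ℕ} (N : Matrix (Fin n) (Fin n) ℂ → ℝ)
    (hUI : ∀ U V A : Matrix (Fin n) (Fin n) ℂ, U ∈ Matrix.unitaryGroup (Fin n) ℂ →
      V ∈ Matrix.unitaryGroup (Fin n) ℂ → N (U * A * V) = N A)
    (Y : Matrix (Fin n) (Fin n) ℂ) (hY : IsUnit Y) : N Yᴴ = N Y := by
  obtain ⟨U, V, d, hU, hV, hd, rfl⟩ := aux_svd Y hY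
  have hU' : Uᴴ ∈ Matrix.unitaryGroup (Fin n) ℂ := Unitary.star_mem hU
  have hV' : Vᴴ ∈ Matrix.unitaryGroup (Fin n) ℂ := Unitary.star_mem hV
  rw [hUI _ _ _ hU hV', Matrix.conjTranspose_mul, Matrix.conjTranspose_mul,
    Matrix.conjTranspose_conjTranspose, ← mul_assoc, hUI _ _ _ hV hU',
    Matrix.diagonal_conjTranspose]
  congr 2
  funext i
  simp

lemma aux_re_le {n : ℕ} (N : Matrix (Fin n) (Fin n) ℂ → ℝ)
    (hNs : ∀ (c : ℂ) (A : Matrix (Fin n) (Fin n) ℂ), N (c • A) = ‖c‖ * N A)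
    (hNa : ∀ A B : Matrix (Fin n) (Fin n) ℂ, N (A + B) ≤ N A + N B)
    (hUI : ∀ U V A : Matrix (Fin n) (Fin n) ℂ, U ∈ Matrix.unitaryGroup (Fin n) ℂ →
      V ∈ Matrix.unitaryGroup (Fin n) ℂ → N (U * A * V) = N A)
    (Y : Matrix (Fin n) (Fin n) ℂ) (hY : IsUnit Y) (θ : ℝ) :
    N (matRe (Complex.exp (θ * Complex.I) • Y)) ≤ N Y := by
  have h := hNa (Complex.exp (θ * Complex.I) • Y) (Complex.exp (θ * Complex.I) • Y)ᴴ
  rw [Matrix.conjTranspose_smul, hNs, hNs, aux_conj N hUI Y hY, norm_star,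
    Complex.norm_exp_ofReal_mul_I] at h
  rw [matRe, hNs, Matrix.conjTranspose_smul]
  norm_num at h ⊢
  linarith

lemma aux_form {n : ℕ} (A : Matrix (Fin n) (Fin n) ℂ) (hA : A.PosDef) (u v : Fin n → ℂ) :
    ‖star u ⬝ᵥ A *ᵥ v‖ ≤ ((star u ⬝ᵥ A *ᵥ u).re + (star v ⬝ᵥ A *ᵥ v).re) / 2 := by
  set w := star u ⬝ᵥ A *ᵥ v with hw
  have hw' : star v ⬝ᵥ A *ᵥ u = (starRingEnd ℂ) w := by
    rw [starRingEnd_apply, hw, Matrix.star_dotProduct, Matrix.star_mulVec, hA.1.eq,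
      ← Matrix.dotProduct_mulVec]
  obtain ⟨c, hc, hcw⟩ : ∃ c : ℂ, ‖c‖ = 1 ∧ c * w = ‖w‖ := by
    by_cases h : w = 0
    · exact ⟨1, by simp, by simp [h]⟩
    · have hn : (‖w‖ : ℂ) ≠ 0 := by simpa using h
      refine ⟨(starRingEnd ℂ) w / ‖w‖, by simp [h], ?_⟩
      rw [div_mul_eq_mul_div, div_eq_iff hn, mul_comm, Complex.mul_conj, Complex.normSq_eq_norm_sq]
      push_cast; ring
  have hpos := hA.posSemidef.re_dotProduct_nonneg (u - c • v)
  have e : star (u - c • v) ⬝ᵥ A *ᵥ (u - c • v) = star u ⬝ᵥ A *ᵥ u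
      + (starRingEnd ℂ c * c) * (star v ⬝ᵥ A *ᵥ v) - c * w - (starRingEnd ℂ) (c * w) := by
    rw [map_mul, ← hw', hw]
    simp only [star_sub, star_smul, Matrix.mulVec_sub, Matrix.mulVec_smul, sub_dotProduct,
      dotProduct_sub, smul_dotProduct, dotProduct_smul, smul_eq_mul, starRingEnd_apply]
    ring
  rw [e, hcw, mul_comm _ c, Complex.mul_conj, Complex.normSq_eq_norm_sq, hc] at hpos
  simp at hpos
  linarith

lemma aux_decomp {n : ℕ} (X : Matrix (Fin n) (Fin n) ℂ) : X = matRe X + Complex.I • matIm X := by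
  rw [matRe, matIm, smul_smul]
  have : Complex.I * (1 / (2 * Complex.I)) = 1 / 2 := by
    field_simp
  rw [this, ← smul_add]
  ext i j
  simp
  ring

lemma aux_isUnit {n : ℕ} (X : Matrix (Fin n) (Fin n) ℂ)
    (hA : (matRe X).PosDef) (hB : (matIm X).PosDef) : IsUnit X := by
  rw [← Matrix.mulVec_injective_iff_isUnit]
  intro x y hxy
  by_contra hne
  have hne' : x - y ≠ 0 := sub_ne_zero.2 hne
  have h0 : X *ᵥ (x - y) = 0 := by rw [Matrix.mulVec_sub]; exact sub_eq_zero.2 hxy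
  have h1 : star (x - y) ⬝ᵥ X *ᵥ (x - y) = 0 := by rw [h0]; simp
  rw [aux_decomp X, Matrix.add_mulVec, Matrix.smul_mulVec, dotProduct_add, dotProduct_smul] at h1
  have hp := hA.re_dotProduct_pos hne'
  have hq := hB.dotProduct_mulVec_pos hne'
  have hq' := (Complex.lt_def.1 hq).2
  have := congrArg Complex.re h1
  simp only [Complex.add_re, smul_eq_mul, Complex.mul_re, Complex.I_re, Complex.I_im, zero_mul,
    one_mul, ← hq', Complex.zero_im, Complex.zero_re, sub_zero, add_zero] at this
  exact absurd this hp.ne'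

lemma aux_entry {n : ℕ} (U V A : Matrix (Fin n) (Fin n) ℂ) (i : Fin n) :
    (Uᴴ * A * V) i i = star (fun k => U k i) ⬝ᵥ A *ᵥ (fun k => V k i) := by
  rw [mul_assoc]
  simp [Matrix.mul_apply, dotProduct, Matrix.mulVec]

lemma aux_main {n : ℕ} (N : Matrix (Fin n) (Fin n) ℂ → ℝ)
    (hN0 : ∀ A : Matrix (Fin n) (Fin n) ℂ, N A = 0 ↔ A = 0)
    (hNs : ∀ (c : ℂ) (A : Matrix (Fin n) (Fin n) ℂ), N (c • A) = ‖c‖ * N A)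
    (hNa : ∀ A B : Matrix (Fin n) (Fin n) ℂ, N (A + B) ≤ N A + N B)
    (hUI : ∀ U V A : Matrix (Fin n) (Fin n) ℂ, U ∈ Matrix.unitaryGroup (Fin n) ℂ →
      V ∈ Matrix.unitaryGroup (Fin n) ℂ → N (U * A * V) = N A)
    (X : Matrix (Fin n) (Fin n) ℂ)
    (hA : (matRe X).PosDef) (hB : (matIm X).PosDef) :
    N X ≤ N (matRe X + matIm X) := by
  obtain ⟨U, V, d, hU, hV, hd, hX⟩ := aux_svd X (aux_isUnit X hA hB)
  have hU' : Uᴴ ∈ Matrix.unitaryGroup (Fin n) ℂ := Unitary.star_mem hU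
  have hV' : Vᴴ ∈ Matrix.unitaryGroup (Fin n) ℂ := Unitary.star_mem hV
  have hdX : Uᴴ * X * V = Matrix.diagonal (fun i => (d i : ℂ)) := by
    have h1 : Uᴴ * U = 1 := Matrix.mem_unitaryGroup_iff'.1 hU
    have h2 : Vᴴ * V = 1 := Matrix.mem_unitaryGroup_iff'.1 hV
    rw [hX]
    calc _ = (Uᴴ * U) * Matrix.diagonal (fun i => (d i : ℂ)) * (Vᴴ * V) := by
          simp only [mul_assoc]
      _ = _ := by rw [h1, h2, one_mul, mul_one]
  set S := matRe X + matIm X with hS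
  have hSp : S.PosDef := hA.add hB
  let T := (1 / 2 : ℂ) • (Uᴴ * S * U + Vᴴ * S * V)
  have hT : N T ≤ N S := by
    have h := hNa (Uᴴ * S * U) (Vᴴ * S * V)
    rw [hUI _ _ _ hU' hU, hUI _ _ _ hV' hV] at h
    simp only [T, hNs]
    norm_num
    linarith
  let b : Fin n → ℝ := fun i => (T i i).re
  have hTH : T.IsHermitian := by
    have := hSp.1.eq
    simp [T, Matrix.IsHermitian, Matrix.conjTranspose_mul, this, mul_assoc]
  have hb : ∀ i, (b i : ℂ) = T i i := fun i => hTH.coe_re_apply_self i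
  have hdb : ∀ i, d i ≤ b i := by
    intro i
    have h1 : (d i : ℂ) = (Uᴴ * X * V) i i := by rw [hdX]; simp
    have h2 : d i = ‖(Uᴴ * X * V) i i‖ := by
      rw [← h1, Complex.norm_real, Real.norm_of_nonneg (hd i)]
    have hAf := aux_form _ hA (fun k => U k i) (fun k => V k i)
    have hBf := aux_form _ hB (fun k => U k i) (fun k => V k i)
    have h3 : b i = ((star (fun k => U k i) ⬝ᵥ S *ᵥ (fun k => U k i)).re
        + (star (fun k => V k i) ⬝ᵥ S *ᵥ (fun k => V k i)).re) / 2 := by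
      simp only [b, T, Matrix.smul_apply, Matrix.add_apply, aux_entry, smul_eq_mul]
      rw [show (1 / 2 : ℂ) = ((1 / 2 : ℝ) : ℂ) by norm_num, Complex.re_ofReal_mul]
      simp only [Complex.add_re]
      ring
    rw [h2, h3, aux_entry, hS]
    conv_lhs => rw [aux_decomp X]
    simp only [Matrix.add_mulVec, Matrix.smul_mulVec, dotProduct_add, dotProduct_smul,
      Complex.add_re]
    refine (norm_add_le _ _).trans ?_
    rw [norm_smul, Complex.norm_I, one_mul]
    linarith
  calc N X = N (Matrix.diagonal (fun i => (d i : ℂ))) := by rw [← hdX, hUI _ _ _ hU' hV]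
    _ ≤ N (Matrix.diagonal (fun i => (b i : ℂ))) := aux_diag_mono N hNs hNa hUI d b hd hdb
    _ = N (Matrix.diagonal (fun i => T i i)) := by simp only [hb]
    _ ≤ N T := aux_pinch N hN0 hNs hNa hUI T
    _ ≤ N S := hT

lemma aux_rot {n : ℕ} (X : Matrix (Fin n) (Fin n) ℂ) :
    matRe X + matIm X
      = ((√2 : ℝ) : ℂ) • matRe (Complex.exp (((-(Real.pi / 4) : ℝ) : ℂ) * Complex.I) • X) := by
  have h2 : ((√2 : ℝ) : ℂ) * ((√2 : ℝ) : ℂ) = 2 := by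
    rw [← Complex.ofReal_mul, Real.mul_self_sqrt (by norm_num)]; norm_num
  have he : Complex.exp (((-(Real.pi / 4) : ℝ) : ℂ) * Complex.I)
      = ((√2 : ℝ) : ℂ) / 2 * (1 - Complex.I) := by
    rw [Complex.exp_mul_I, ← Complex.ofReal_cos, ← Complex.ofReal_sin, Real.cos_neg, Real.sin_neg,
      Real.cos_pi_div_four, Real.sin_pi_div_four]
    push_cast
    ring
  have hI : (1 / (2 * Complex.I)) = -Complex.I / 2 := by
    rw [div_eq_div_iff (by simp) (by simp)]
    linear_combination (2 : ℂ) * Complex.I_mul_I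
  rw [he, matRe, matIm, matRe, hI]
  ext i j
  simp only [Matrix.add_apply, Matrix.smul_apply, Matrix.sub_apply, Matrix.conjTranspose_apply,
    smul_eq_mul, star_mul', Complex.star_def, map_div₀, map_sub, map_one, Complex.conj_ofReal,
    Complex.conj_I, map_ofNat, map_mul]
  linear_combination (-(1 / 4 : ℂ) * ((1 - Complex.I) * X i j
    + (1 + Complex.I) * (starRingEnd ℂ) (X j i))) * h2

lemma aux_prod {n : ℕ} (N : Matrix (Fin n) (Fin n) ℂ → ℝ)
    (hnn : ∀ A, 0 ≤ N A)
    (hSM : ∀ A B : Matrix (Fin n) (Fin n) ℂ, N (A * B) ≤ N A * N B) (m : ℕ)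
    (X : Fin (m + 1) → Matrix (Fin n) (Fin n) ℂ) :
    N (List.ofFn X).prod ≤ ∏ j, N (X j) := by
  induction m with
  | zero => simp
  | succ k ih =>
    rw [List.ofFn_succ, List.prod_cons, Fin.prod_univ_succ]
    exact (hSM _ _).trans (mul_le_mul_of_nonneg_left (ih _) (hnn _))

theorem stmt_8 {n : ℕ} (N : Matrix (Fin n) (Fin n) ℂ → ℝ)
    (hN0 : ∀ A : Matrix (Fin n) (Fin n) ℂ, N A = 0 ↔ A = 0)
    (hNs : ∀ (c : ℂ) (A : Matrix (Fin n) (Fin n) ℂ), N (c • A) = ‖c‖ * N A)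
    (hNa : ∀ A B : Matrix (Fin n) (Fin n) ℂ, N (A + B) ≤ N A + N B)
    (hUI : ∀ U V A : Matrix (Fin n) (Fin n) ℂ, U ∈ Matrix.unitaryGroup (Fin n) ℂ →
      V ∈ Matrix.unitaryGroup (Fin n) ℂ → N (U * A * V) = N A)
    (hSM : ∀ A B : Matrix (Fin n) (Fin n) ℂ, N (A * B) ≤ N A * N B)
    {m : ℕ} (hm : 1 ≤ m)
    (X : Fin m → Matrix (Fin n) (Fin n) ℂ)
    (hX : ∀ j, (matRe (X j)).PosDef ∧ (matIm (X j)).PosDef) :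
    gnr N (List.ofFn X).prod ≤ (2 : ℝ) ^ ((m : ℝ) / 2) * ∏ j, gnr N (X j) := by
  have hnn := aux_nonneg N hN0 hNs hNa
  have hU : ∀ j, IsUnit (X j) := fun j => aux_isUnit _ (hX j).1 (hX j).2
  have hUp : IsUnit (List.ofFn X).prod := by
    apply List.prod_isUnit
    intro a ha
    obtain ⟨j, rfl⟩ := (List.mem_ofFn' _ _).1 ha
    exact hU j
  have h1 : gnr N (List.ofFn X).prod ≤ N (List.ofFn X).prod :=
    ciSup_le fun θ => aux_re_le N hNs hNa hUI _ hUp θ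
  have h2 : ∀ j, N (X j) ≤ √2 * gnr N (X j) := by
    intro j
    have hb : BddAbove (Set.range fun θ : ℝ => N (matRe (Complex.exp (θ * Complex.I) • X j))) := by
      refine ⟨N (X j), ?_⟩
      rintro _ ⟨θ, rfl⟩
      exact aux_re_le N hNs hNa hUI _ (hU j) θ
    have h3 := le_ciSup hb (-(Real.pi / 4))
    have h4 := aux_main N hN0 hNs hNa hUI (X j) (hX j).1 (hX j).2
    rw [aux_rot, hNs, Complex.norm_real, Real.norm_of_nonneg (Real.sqrt_nonneg 2)] at h4
    exact h4.trans (mul_le_mul_of_nonneg_left h3 (Real.sqrt_nonneg 2))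
  have h5 : N (List.ofFn X).prod ≤ ∏ j, N (X j) := by
    obtain ⟨k, rfl⟩ : ∃ k, m = k + 1 := ⟨m - 1, by omega⟩
    exact aux_prod N hnn hSM k X
  have h6 : (2 : ℝ) ^ ((m : ℝ) / 2) = √2 ^ m := by
    rw [Real.sqrt_eq_rpow, ← Real.rpow_natCast, ← Real.rpow_mul (by norm_num)]
    congr 1
    ring
  calc gnr N (List.ofFn X).prod ≤ ∏ j, N (X j) := h1.trans h5
    _ ≤ ∏ j, (√2 * gnr N (X j)) := Finset.prod_le_prod (fun j _ => hnn _) (fun j _ => h2 j)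
    _ = _ := by rw [Finset.prod_mul_distrib, h6]; simp
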